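/- Let F be a field, let t ≥ 1 and n ≥ 1, and let x_1, …, x_t be pairwise distinct nonzero elements of F. Let f be a polynomial over F of degree less than t with f(0) = S (the secret), and let f_1, …, f_n be polynomials over F, each of degree less than t, such that ∑_{i=1}^n f_i(0) = 0 (each f_i shares a refreshing value w_i = f_i(0) with ∑_i w_i = 0). Define the refreshed shares S'_j = f(x_j) + ∑_{i=1}^n f_i(x_j) for j = 1,…,t. Then the Lagrange interpolating polynomial through the points (x_1, S'_1), …, (x_t, S'_t), evaluated at 0, equals S; that is, refreshing the Shamir shares by adding the subshares of refreshing values summing to 0 preserves the shared secret. -/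

import Mathlib

open Polynomial

/-- Correctness of the Shamir share-refreshing scheme based on the
`(⊕,⊕)`-homomorphism property: if a secret `S` is shared by a polynomial `f`
of degree `< t` with `f 0 = S` at pairwise distinct nonzero points
`x 1, …, x t`, and refreshing polynomials `f₁, …, fₙ` of degree `< t` satisfy
`∑ i, fᵢ 0 = 0`, then Lagrange interpolation through the refreshed shares
`S' j = f (x j) + ∑ i, fᵢ (x j)`, evaluated at `0`, still yields `S`. -/
theorem shamir_refreshing_preserves_secret
    (F : Type*) [Field F]
    (t n : ℕ) (ht : 1 ≤ t) (hn : 1 ≤ n)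
    (x : Fin t → F) (hx : Function.Injective x) (hx0 : ∀ j, x j ≠ 0)
    (f : F[X]) (hf : f.degree < t)
    (S : F) (hfS : f.eval 0 = S)
    (fs : Fin n → F[X]) (hfs : ∀ i, (fs i).degree < t)
    (hfs0 : ∑ i, (fs i).eval 0 = 0)
    (S' : Fin t → F)
    (hS' : ∀ j, S' j = f.eval (x j) + ∑ i, (fs i).eval (x j)) :
    (Lagrange.interpolate Finset.univ x S').eval 0 = S := by
  have hdeg : (f + ∑ i, fs i).degree < t := by
    rw [← mem_degreeLT] at hf ⊢
    exact add_mem hf (sum_mem fun i _ => mem_degreeLT.2 (hfs i))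
  have hinterp : f + ∑ i, fs i = Lagrange.interpolate Finset.univ x S' :=
    Lagrange.eq_interpolate_of_eval_eq S' hx.injOn (by simpa using hdeg)
      fun j _ => by rw [hS', eval_add, eval_finsetSum]
  rw [← hinterp, eval_add, eval_finsetSum, hfs0, add_zero, hfS]
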